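/- With p, n, k and the ideal I = I(g_0, g_1, g_2, g_3) as in the context, the images modulo I of the monomials X^u * X^w, where u ranges over all finite lists with entries in {1, 3} ⊆ Fin 4 and w ranges over all finite lists with entries in {0, 2} ⊆ Fin 4, form a basis of the quotient FreeAlgebra (ZMod (p^n)) (Fin 4) ⧸ I as a ZMod (p^n)-module. -/

import Mathlib

section CyclicAlgebra

open Polynomial

section Derivation

variable {R : Type*} [CommRing R] (π : R) (f : R[X])

/-- The endomorphism `X ↦ X + π f` of `R[X]`. -/
noncomputable def shiftHom : R[X] →ₐ[R] R[X] := aeval (X + C π * f)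

/-- The homomorphism sending `X` to the triangular matrix with rows `(X, f)` and `(0, X + π f)`. -/
noncomputable def shiftMatrixHom : R[X] →ₐ[R] Matrix (Fin 2) (Fin 2) R[X] :=
  aeval !![X, f; 0, X + C π * f]

theorem shiftMatrixHom_entries (q : R[X]) :
    shiftMatrixHom π f q 0 0 = q ∧ shiftMatrixHom π f q 1 0 = 0 ∧
      shiftMatrixHom π f q 1 1 = shiftHom π f q ∧
      shiftHom π f q = q + C π * shiftMatrixHom π f q 0 1 := by
  induction q using Polynomial.induction_on' with
  | add p q hp hq =>
    obtain ⟨h1, h2, h3, h4⟩ := hp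
    obtain ⟨h5, h6, h7, h8⟩ := hq
    simp only [map_add, Matrix.add_apply, h1, h2, h3, h5, h6, h7, add_zero, true_and]
    rw [h4, h8]; ring
  | monomial m a =>
    induction m with
    | zero =>
      simp [shiftMatrixHom, shiftHom, Matrix.algebraMap_matrix_apply]
    | succ m ih =>
      obtain ⟨h1, h2, h3, h4⟩ := ih
      have hX : shiftMatrixHom π f X = !![X, f; 0, X + C π * f] := by simp [shiftMatrixHom]
      have hX' : shiftHom π f X = X + C π * f := by simp [shiftHom]
      rw [← monomial_mul_X, map_mul, map_mul, hX, hX']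
      simp only [Matrix.mul_apply, Fin.sum_univ_two, h1, h2, h3]
      simp only [Matrix.of_apply, Matrix.cons_val', Matrix.cons_val_zero, Matrix.cons_val_one,
        Matrix.cons_val_fin_one, mul_zero, add_zero, zero_mul, zero_add, true_and]
      rw [h4]; ring

/-- The twisted derivation `q ↦ (q(X + π f) - q) / π` of `R[X]`. -/
noncomputable def shiftDeriv : R[X] →ₗ[R] R[X] :=
  Matrix.entryLinearMap R R[X] 0 1 ∘ₗ (shiftMatrixHom π f).toLinearMap

theorem shiftDeriv_apply (q : R[X]) : shiftDeriv π f q = shiftMatrixHom π f q 0 1 := rfl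

@[simp] theorem shiftDeriv_X : shiftDeriv π f X = f := by
  simp [shiftDeriv_apply, shiftMatrixHom]

@[simp] theorem shiftDeriv_one : shiftDeriv π f 1 = 0 := by
  simp [shiftDeriv_apply]

@[simp] theorem shiftHom_X : shiftHom π f X = X + C π * f := by simp [shiftHom]

theorem shiftHom_eq (q : R[X]) : shiftHom π f q = q + C π * shiftDeriv π f q :=
  (shiftMatrixHom_entries π f q).2.2.2

theorem shiftDeriv_mul (p q : R[X]) :
    shiftDeriv π f (p * q) = p * shiftDeriv π f q + shiftDeriv π f p * shiftHom π f q := by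
  simp only [shiftDeriv_apply, map_mul, Matrix.mul_apply, Fin.sum_univ_two,
    (shiftMatrixHom_entries π f _).1, (shiftMatrixHom_entries π f _).2.2.1]

variable {π} in
theorem shiftHom_bijective (hπ : IsNilpotent π) : Function.Bijective (shiftHom π f) := by
  have h : (shiftHom π f).toLinearMap = 1 + π • shiftDeriv π f := by
    refine LinearMap.ext fun q => ?_
    simp [shiftHom_eq, smul_eq_C_mul]
  have h2 : IsUnit (shiftHom π f).toLinearMap := by
    rw [h]
    refine IsNilpotent.isUnit_one_add ?_
    obtain ⟨n, hn⟩ := hπ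
    exact ⟨n, by rw [_root_.smul_pow, hn, zero_smul]⟩
  exact (Module.End.isUnit_iff _).1 h2

end Derivation

section Span

variable {R : Type*} [CommRing R] {π : R} {f : R[X]} {A : Type*} [Ring A] [Algebra R A]

theorem aeval_mul_eq {x y : A} (h : y * x = x * aeval y (X + C π * f) + aeval y f) (q : R[X]) :
    aeval y q * x = x * aeval y (shiftHom π f q) + aeval y (shiftDeriv π f q) := by
  induction q using Polynomial.induction_on' with
  | add p q hp hq =>
    simp only [map_add, add_mul, hp, hq, mul_add]; abel
  | monomial m a =>
    induction m with
    | zero =>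
      rw [monomial_zero_left, ← algebraMap_eq, AlgHom.commutes,
        Algebra.algebraMap_eq_smul_one (A := R[X]), map_smul]
      simp [Algebra.algebraMap_eq_smul_one]
    | succ m ih =>
      rw [← X_mul_monomial, map_mul, mul_assoc, ih, map_mul, shiftDeriv_mul, aeval_X, map_add,
        map_mul, map_mul, map_mul, aeval_X, mul_add, ← mul_assoc, h, shiftHom_X, shiftDeriv_X]
      simp only [add_mul, mul_assoc]
      abel

/-- If `c * x ∈ D * K` for `c ∈ K` and `x ∈ s`, then `K * adjoin s ≤ D * K`. -/
theorem mul_adjoin_le {K D : Subalgebra R A} {s : Set A}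
    (h : ∀ c ∈ K, ∀ x ∈ s, c * x ∈ D.toSubmodule * K.toSubmodule) :
    K.toSubmodule * (Algebra.adjoin R s).toSubmodule ≤ D.toSubmodule * K.toSubmodule := by
  rw [Submodule.mul_le]
  intro c hc d hd
  change d ∈ Algebra.adjoin R s at hd
  induction hd using Algebra.adjoin_induction generalizing c with
  | mem x hx => exact h c hc x hx
  | algebraMap r =>
    rw [← Algebra.commutes]
    exact Submodule.mul_mem_mul (D.algebraMap_mem r) hc
  | add x y _ _ hx hy => rw [mul_add]; exact add_mem (hx c hc) (hy c hc)
  | mul x y _ _ hx hy =>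
    rw [← mul_assoc]
    have key : ∀ z ∈ D.toSubmodule * K.toSubmodule, z * y ∈ D.toSubmodule * K.toSubmodule := by
      intro z hz
      induction hz using Submodule.mul_induction_on' with
      | mem_mul_mem d hd k hk =>
        rw [mul_assoc]
        have := Submodule.mul_mem_mul hd (hy k hk)
        rwa [← mul_assoc, D.isIdempotentElem_toSubmodule.eq] at this
      | add a _ b _ ha hb => rw [add_mul]; exact add_mem ha hb
    exact key _ (hx c hc)

/-- If `x * c ∈ K * D` for `c ∈ K` and `x ∈ s`, then `adjoin s * K ≤ K * D`. -/
theorem adjoin_mul_le {K D : Subalgebra R A} {s : Set A}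
    (h : ∀ c ∈ K, ∀ x ∈ s, x * c ∈ K.toSubmodule * D.toSubmodule) :
    (Algebra.adjoin R s).toSubmodule * K.toSubmodule ≤ K.toSubmodule * D.toSubmodule := by
  rw [Submodule.mul_le]
  intro d hd c hc
  change d ∈ Algebra.adjoin R s at hd
  induction hd using Algebra.adjoin_induction generalizing c with
  | mem x hx => exact h c hc x hx
  | algebraMap r =>
    rw [Algebra.commutes]
    exact Submodule.mul_mem_mul hc (D.algebraMap_mem r)
  | add x y _ _ hx hy => rw [add_mul]; exact add_mem (hx c hc) (hy c hc)
  | mul y x _ _ hy hx =>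
    rw [mul_assoc]
    have key : ∀ z ∈ K.toSubmodule * D.toSubmodule, y * z ∈ K.toSubmodule * D.toSubmodule := by
      intro z hz
      induction hz using Submodule.mul_induction_on' with
      | mem_mul_mem k hk d hd =>
        rw [← mul_assoc]
        have := Submodule.mul_mem_mul (hy k hk) hd
        rwa [mul_assoc, D.isIdempotentElem_toSubmodule.eq] at this
      | add a _ b _ ha hb => rw [mul_add]; exact add_mem ha hb
    exact key _ (hx c hc)

theorem right_mul_left_le {x y : A} (h : y * x = x * aeval y (X + C π * f) + aeval y f) :
    (Algebra.adjoin R {y}).toSubmodule * (Algebra.adjoin R {x}).toSubmodule ≤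
      (Algebra.adjoin R {x}).toSubmodule * (Algebra.adjoin R {y}).toSubmodule := by
  refine mul_adjoin_le ?_
  rintro c hc _ rfl
  rw [Algebra.adjoin_singleton_eq_range_aeval] at hc
  obtain ⟨q, rfl⟩ := hc
  change aeval y q * _ ∈ _
  rw [aeval_mul_eq h]
  refine add_mem (Submodule.mul_mem_mul (Algebra.self_mem_adjoin_singleton R _) ?_) ?_
  · exact aeval_mem_adjoin_singleton R y
  · rw [← one_mul (aeval y _)]
    exact Submodule.mul_mem_mul (one_mem (Algebra.adjoin R _)) (aeval_mem_adjoin_singleton R y)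

theorem left_mul_right_le (hπ : IsNilpotent π) {x y : A}
    (h : y * x = x * aeval y (X + C π * f) + aeval y f) :
    (Algebra.adjoin R {x}).toSubmodule * (Algebra.adjoin R {y}).toSubmodule ≤
      (Algebra.adjoin R {y}).toSubmodule * (Algebra.adjoin R {x}).toSubmodule := by
  refine adjoin_mul_le ?_
  rintro c hc _ rfl
  rw [Algebra.adjoin_singleton_eq_range_aeval] at hc
  obtain ⟨q, rfl⟩ := hc
  obtain ⟨q, rfl⟩ := (shiftHom_bijective f hπ).2 q
  change _ * aeval y (shiftHom π f q) ∈ _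
  rw [eq_sub_of_add_eq (aeval_mul_eq h q).symm]
  refine sub_mem (Submodule.mul_mem_mul ?_ (Algebra.self_mem_adjoin_singleton R _)) ?_
  · exact aeval_mem_adjoin_singleton R y
  · rw [← mul_one (aeval y _)]
    exact Submodule.mul_mem_mul (aeval_mem_adjoin_singleton R y) (one_mem (Algebra.adjoin R _))

/-- A product of subalgebras `D * K` which absorbs left multiplication by a generating set of `A`
is everything. -/
theorem mul_eq_top_of_generators {D K : Subalgebra R A} {s : Set A} (hs : Algebra.adjoin R s = ⊤)
    (h : ∀ x ∈ s, ∀ z ∈ D.toSubmodule * K.toSubmodule, x * z ∈ D.toSubmodule * K.toSubmodule) :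
    D.toSubmodule * K.toSubmodule = ⊤ := by
  have key : ∀ a ∈ Algebra.adjoin R s, ∀ z ∈ D.toSubmodule * K.toSubmodule,
      a * z ∈ D.toSubmodule * K.toSubmodule := by
    intro a ha
    induction ha using Algebra.adjoin_induction with
    | mem x hx => exact h x hx
    | algebraMap r => intro z hz; rw [← Algebra.smul_def]; exact Submodule.smul_mem _ _ hz
    | add a b _ _ ha hb => intro z hz; rw [add_mul]; exact add_mem (ha z hz) (hb z hz)
    | mul a b _ _ ha hb => intro z hz; rw [mul_assoc]; exact ha _ (hb z hz)
  rw [eq_top_iff]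
  intro a _
  have h1 : (1 : A) ∈ D.toSubmodule * K.toSubmodule := by
    rw [← one_mul (1 : A)]
    exact Submodule.mul_mem_mul (one_mem D) (one_mem K)
  simpa using key a (by rw [hs]; trivial) 1 h1

theorem left_mul_absorb {D K : Subalgebra R A} {x : A} (hx : x ∈ D) :
    ∀ z ∈ D.toSubmodule * K.toSubmodule, x * z ∈ D.toSubmodule * K.toSubmodule := by
  intro z hz
  have : x * z ∈ D.toSubmodule * (D.toSubmodule * K.toSubmodule) := Submodule.mul_mem_mul hx hz
  rwa [← mul_assoc, D.isIdempotentElem_toSubmodule.eq] at this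

theorem right_mul_absorb {D K P : Subalgebra R A} (hP : P ≤ K)
    (h : P.toSubmodule * D.toSubmodule ≤ D.toSubmodule * P.toSubmodule) {x : A} (hx : x ∈ P) :
    ∀ z ∈ D.toSubmodule * K.toSubmodule, x * z ∈ D.toSubmodule * K.toSubmodule := by
  intro z hz
  have h1 : x * z ∈ P.toSubmodule * (D.toSubmodule * K.toSubmodule) := Submodule.mul_mem_mul hx hz
  have h2 : P.toSubmodule * (D.toSubmodule * K.toSubmodule) ≤ D.toSubmodule * K.toSubmodule := by
    calc P.toSubmodule * (D.toSubmodule * K.toSubmodule)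
        ≤ D.toSubmodule * P.toSubmodule * K.toSubmodule := by
          rw [← mul_assoc]; exact mul_le_mul_left h _
      _ ≤ D.toSubmodule * K.toSubmodule * K.toSubmodule :=
          mul_le_mul_left (mul_le_mul_right (show P.toSubmodule ≤ K.toSubmodule from hP) _) _
      _ = _ := by rw [mul_assoc, K.isIdempotentElem_toSubmodule.eq]
  exact h2 h1

end Span

section ShiftAlgebra

variable {R : Type*} [CommRing R] (π : R) (f : R[X])

/-- The defining relation `y x = x (y + π f(y)) + f(y)`, with `x = ι 0` and `y = ι 1`. -/
inductive ShiftRel : FreeAlgebra R (Fin 2) → FreeAlgebra R (Fin 2) → Prop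
  | mk : ShiftRel (FreeAlgebra.ι R 1 * FreeAlgebra.ι R 0)
      (FreeAlgebra.ι R 0 * aeval (FreeAlgebra.ι R 1) (X + C π * f) +
        aeval (FreeAlgebra.ι R (1 : Fin 2)) f)

/-- The algebra generated by `x`, `y` subject to `y x = x (y + π f(y)) + f(y)`. -/
abbrev ShiftAlgebra : Type _ := RingQuot (ShiftRel π f)

namespace ShiftAlgebra

/-- The first generator. -/
noncomputable def x : ShiftAlgebra π f := RingQuot.mkAlgHom R _ (FreeAlgebra.ι R 0)

/-- The second generator. -/
noncomputable def y : ShiftAlgebra π f := RingQuot.mkAlgHom R _ (FreeAlgebra.ι R 1)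

theorem rel : y π f * x π f = x π f * aeval (y π f) (X + C π * f) + aeval (y π f) f := by
  have := RingQuot.mkAlgHom_rel R (ShiftRel.mk (π := π) (f := f))
  rw [map_mul, map_add, map_mul, ← aeval_algHom_apply, ← aeval_algHom_apply] at this
  exact this

theorem adjoin_eq_top : Algebra.adjoin R {x π f, y π f} = ⊤ := by
  have h := congrArg (Subalgebra.map (RingQuot.mkAlgHom R (ShiftRel π f)))
    (FreeAlgebra.adjoin_range_ι R (Fin 2))
  rw [AlgHom.map_adjoin, Algebra.map_top, (AlgHom.range_eq_top _).2
    (RingQuot.mkAlgHom_surjective R _)] at h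
  rw [← h]
  congr 1
  ext z
  simp [x, y, eq_comm]

variable {π f} {A : Type*} [Ring A] [Algebra R A]

theorem exists_lift {a b : A} (h : b * a = a * aeval b (X + C π * f) + aeval b f) :
    ∃ φ : ShiftAlgebra π f →ₐ[R] A, φ (x π f) = a ∧ φ (y π f) = b := by
  refine ⟨RingQuot.liftAlgHom R ⟨FreeAlgebra.lift R ![a, b], ?_⟩, ?_, ?_⟩
  · rintro _ _ ⟨⟩
    rw [map_mul, map_add, map_mul, ← aeval_algHom_apply, ← aeval_algHom_apply]
    simpa using h
  · simp [x, RingQuot.liftAlgHom_mkAlgHom_apply]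
  · simp [y, RingQuot.liftAlgHom_mkAlgHom_apply]

theorem mul_adjoin_y_eq_top :
    (Algebra.adjoin R {x π f}).toSubmodule * (Algebra.adjoin R {y π f}).toSubmodule = ⊤ := by
  refine mul_eq_top_of_generators (adjoin_eq_top π f) ?_
  rintro _ (rfl | rfl)
  · exact left_mul_absorb (Algebra.self_mem_adjoin_singleton R _)
  · exact right_mul_absorb le_rfl (right_mul_left_le (rel π f))
      (Algebra.self_mem_adjoin_singleton R _)

theorem mul_adjoin_x_eq_top (hπ : IsNilpotent π) :
    (Algebra.adjoin R {y π f}).toSubmodule * (Algebra.adjoin R {x π f}).toSubmodule = ⊤ := by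
  refine mul_eq_top_of_generators (adjoin_eq_top π f) ?_
  rintro _ (rfl | rfl)
  · exact right_mul_absorb le_rfl (left_mul_right_le hπ (rel π f))
      (Algebra.self_mem_adjoin_singleton R _)
  · exact left_mul_absorb (Algebra.self_mem_adjoin_singleton R _)

theorem span_range_pow_mul_pow (a b : A) :
    Submodule.span R (Set.range fun ij : ℕ × ℕ => a ^ ij.1 * b ^ ij.2) =
      (Algebra.adjoin R {a}).toSubmodule * (Algebra.adjoin R {b}).toSubmodule := by
  rw [Algebra.adjoin_eq_span, Algebra.adjoin_eq_span, Submodule.span_mul_span]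
  congr 1
  ext z
  simp [Set.mem_mul, Submonoid.mem_closure_singleton]

theorem linearIndependent_single_X_pow :
    LinearIndependent R (fun ij : ℕ × ℕ => Finsupp.single ij.1 (X ^ ij.2 : R[X])) := by
  convert ((Finsupp.basis fun _ : ℕ => Polynomial.basisMonomials R).reindex
    (Equiv.sigmaEquivProd ℕ ℕ)).linearIndependent using 1
  ext1 ⟨i, j⟩
  simp [← X_pow_eq_monomial]

/-- Monomials that are independent after applying a linear map form a basis if they span. -/
theorem exists_basis_pow_mul_pow {a b : A} {E : Type*} [AddCommGroup E] [Module R E]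
    (htop : (Algebra.adjoin R {a}).toSubmodule * (Algebra.adjoin R {b}).toSubmodule = ⊤)
    (N : A →ₗ[R] E) (hN : LinearIndependent R fun ij : ℕ × ℕ => N (a ^ ij.1 * b ^ ij.2)) :
    ∃ β : Module.Basis (ℕ × ℕ) R A, ∀ ij, β ij = a ^ ij.1 * b ^ ij.2 :=
  ⟨Module.Basis.mk (LinearIndependent.of_comp N hN) (by rw [span_range_pow_mul_pow, htop]),
    fun ij => by simp⟩

variable (π f) in
theorem exists_basis_x_y :
    ∃ β : Module.Basis (ℕ × ℕ) R (ShiftAlgebra π f),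
      ∀ ij, β ij = x π f ^ ij.1 * y π f ^ ij.2 := by
  let Y : R[X] →ₐ[R] Module.End R (ℕ →₀ R[X]) := Algebra.lsmul R R (ℕ →₀ R[X])
  let P : Module.End R (ℕ →₀ R[X]) :=
    Finsupp.lmapDomain R[X] R Nat.succ ∘ₗ Finsupp.mapRange.linearMap (shiftHom π f).toLinearMap +
      Finsupp.mapRange.linearMap (shiftDeriv π f)
  have hY : ∀ q i p, Y q (Finsupp.single i p) = Finsupp.single i (q * p) := by
    intro q i p
    simp [Y]
  have hP : ∀ i p, P (Finsupp.single i p) =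
      Finsupp.single (i + 1) (shiftHom π f p) + Finsupp.single i (shiftDeriv π f p) := by
    intro i p
    simp [P]
  have hYq : ∀ q, aeval (MulOpposite.op (Y X)) q = MulOpposite.op (Y q) := by
    intro q
    rw [← MulOpposite.unop_inj]
    induction q using Polynomial.induction_on' with
    | add p q hp hq => simp [hp, hq]
    | monomial m a =>
      rw [aeval_monomial, ← C_mul_X_pow_eq_monomial, map_mul, map_pow, ← algebraMap_eq,
        AlgHom.commutes, Algebra.algebraMap_eq_smul_one, Algebra.algebraMap_eq_smul_one]
      simp
  have hrel : MulOpposite.op (Y X) * MulOpposite.op P =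
      MulOpposite.op P * aeval (MulOpposite.op (Y X)) (X + C π * f) +
        aeval (MulOpposite.op (Y X)) f := by
    rw [hYq, hYq, ← MulOpposite.unop_inj]
    refine Finsupp.lhom_ext fun i p => ?_
    simp only [MulOpposite.unop_add, MulOpposite.unop_mul, MulOpposite.unop_op,
      Module.End.mul_apply, LinearMap.add_apply, hY, hP, map_add, map_mul, shiftDeriv_mul,
      shiftHom_X, shiftDeriv_X, add_assoc, ← Finsupp.single_add]
    congr 2
    · ring
    · linear_combination f * shiftHom_eq π f p
  obtain ⟨φ, hx, hy⟩ := exists_lift (A := (Module.End R (ℕ →₀ R[X]))ᵐᵒᵖ) hrel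
  refine exists_basis_pow_mul_pow mul_adjoin_y_eq_top
    (LinearMap.applyₗ (Finsupp.single 0 1) ∘ₗ (MulOpposite.opLinearEquiv R).symm.toLinearMap ∘ₗ
      φ.toLinearMap) ?_
  have hPi : ∀ i : ℕ, (P ^ i) (Finsupp.single 0 1) = Finsupp.single i 1 := by
    intro i
    induction i with
    | zero => simp
    | succ i ih => rw [pow_succ', Module.End.mul_apply, ih, hP]; simp
  have h : ∀ ij : ℕ × ℕ, MulOpposite.unop (φ (x π f ^ ij.1 * y π f ^ ij.2))
      (Finsupp.single 0 1) = Finsupp.single ij.1 (X ^ ij.2) := by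
    intro ij
    simp only [map_mul, map_pow, hx, hy, MulOpposite.unop_mul, MulOpposite.unop_pow,
      MulOpposite.unop_op, Module.End.mul_apply]
    rw [hPi, ← map_pow, hY, mul_one]
  convert linearIndependent_single_X_pow (R := R) using 2 with ij
  · exact h ij
  · rfl

theorem exists_basis_y_x (hπ : IsNilpotent π) :
    ∃ β : Module.Basis (ℕ × ℕ) R (ShiftAlgebra π f),
      ∀ ij, β ij = y π f ^ ij.1 * x π f ^ ij.2 := by
  let σ := LinearEquiv.ofBijective (shiftHom π f).toLinearMap (shiftHom_bijective f hπ)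
  have hσ : ∀ p, σ p = shiftHom π f p := fun p => rfl
  let Y : R[X] →ₐ[R] Module.End R (ℕ →₀ R[X]) := Algebra.lsmul R R (ℕ →₀ R[X])
  let P : Module.End R (ℕ →₀ R[X]) :=
    Finsupp.lmapDomain R[X] R Nat.succ ∘ₗ Finsupp.mapRange.linearMap σ.symm.toLinearMap -
      Finsupp.mapRange.linearMap (shiftDeriv π f ∘ₗ σ.symm.toLinearMap)
  have hY : ∀ q i p, Y q (Finsupp.single i p) = Finsupp.single i (q * p) := by
    intro q i p
    simp [Y]
  have hP : ∀ i p, P (Finsupp.single i (shiftHom π f p)) =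
      Finsupp.single (i + 1) p - Finsupp.single i (shiftDeriv π f p) := by
    intro i p
    simp [P, ← hσ]
  have hrel : Y X * P = P * aeval (Y X) (X + C π * f) + aeval (Y X) f := by
    have hYq : ∀ q, aeval (Y X) q = Y q := by
      intro q
      rw [aeval_algHom_apply, aeval_X_left, AlgHom.id_apply]
    rw [hYq, hYq]
    refine Finsupp.lhom_ext fun i p => ?_
    obtain ⟨p, rfl⟩ := (shiftHom_bijective f hπ).2 p
    simp only [Module.End.mul_apply, LinearMap.add_apply, hY, hP, map_sub]
    rw [← shiftHom_X, ← map_mul, hP, shiftDeriv_mul, shiftDeriv_X, Finsupp.single_add]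
    abel
  obtain ⟨φ, hx, hy⟩ := exists_lift (A := Module.End R (ℕ →₀ R[X])) hrel
  refine exists_basis_pow_mul_pow (mul_adjoin_x_eq_top hπ)
    (LinearMap.applyₗ (Finsupp.single 0 1) ∘ₗ φ.toLinearMap) ?_
  have hPi : ∀ i : ℕ, (P ^ i) (Finsupp.single 0 1) = Finsupp.single i 1 := by
    intro i
    induction i with
    | zero => simp
    | succ i ih =>
      rw [pow_succ', Module.End.mul_apply, ih, ← map_one (shiftHom π f), hP]; simp
  have h : ∀ ij : ℕ × ℕ, φ (y π f ^ ij.1 * x π f ^ ij.2) (Finsupp.single 0 1) =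
      Finsupp.single ij.2 (X ^ ij.1) := by
    intro ij
    simp only [map_mul, map_pow, hx, hy, Module.End.mul_apply]
    rw [hPi, ← map_pow, hY, mul_one]
  convert (linearIndependent_single_X_pow (R := R)).comp Prod.swap Prod.swap_injective
    using 2 with ij
  · exact h ij
  · rfl

end ShiftAlgebra

end ShiftAlgebra

section WordModule

/-- An algebra `S` with, for each letter `a`, a basis `letter a ^ j * pivot a ^ i`. -/
structure LetterData (R S Λ : Type*) [CommRing R] [Ring S] [Algebra R S] where
  letter : Λ → S
  pivot : Λ → S
  basis : Λ → Module.Basis (ℕ × ℕ) R S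
  basis_apply : ∀ a jl, basis a jl = letter a ^ jl.1 * pivot a ^ jl.2

variable {R S V Λ : Type*} [CommRing R] [Ring S] [Algebra R S] [AddCommGroup V] [Module R V]

/-- Prefixing words by a letter. -/
noncomputable def consEnd (R V : Type*) {Λ : Type*} [CommRing R] [AddCommGroup V] [Module R V]
    (a : Λ) : Module.End R (List Λ →₀ V) := Finsupp.lmapDomain V R (List.cons a)

@[simp] theorem consEnd_single (a : Λ) (u : List Λ) (v : V) :
    consEnd R V a (Finsupp.single u v) = Finsupp.single (a :: u) v := by
  simp [consEnd]

namespace LetterData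

variable (D : LetterData R S Λ) (T : Module.End R V)

/-- The action of the `i`-th power of the pivot on `u ⊗ V`, by recursion on the word `u`. -/
noncomputable def wordPow : List Λ → ℕ → V →ₗ[R] (List Λ →₀ V)
  | [], i => Finsupp.lsingle [] ∘ₗ (T ^ i)
  | a :: u, i => (D.basis a).constr R
      (fun jl => (consEnd R V a ^ jl.1) ∘ₗ wordPow u jl.2) (D.pivot a ^ i * D.letter a)

/-- The action of the `i`-th power of the pivot on words with coefficients in `V`. -/
noncomputable def pivotPow (i : ℕ) : Module.End R (List Λ →₀ V) :=
  Finsupp.lsum R fun u => D.wordPow T u i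

/-- The action of `S` for which the letter `a` prefixes words by `a`, and the pivot acts by
`pivotPow`. -/
noncomputable def act (a : Λ) : S →ₗ[R] Module.End R (List Λ →₀ V) :=
  (D.basis a).constr R fun jl => consEnd R V a ^ jl.1 * D.pivotPow T jl.2

theorem pivotPow_single (i : ℕ) (u : List Λ) (v : V) :
    D.pivotPow T i (Finsupp.single u v) = D.wordPow T u i v := by
  simp [pivotPow]

theorem pivotPow_mul_consEnd (i : ℕ) (a : Λ) :
    D.pivotPow T i * consEnd R V a = D.act T a (D.pivot a ^ i * D.letter a) := by
  refine Finsupp.lhom_ext fun u v => ?_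
  rw [Module.End.mul_apply, consEnd_single, pivotPow_single, wordPow, act]
  simp [Module.Basis.constr_apply, Finsupp.sum, LinearMap.sum_apply, pivotPow_single]

theorem act_basis (a : Λ) (j i : ℕ) :
    D.act T a (D.letter a ^ j * D.pivot a ^ i) = consEnd R V a ^ j * D.pivotPow T i := by
  rw [← D.basis_apply a (j, i), act, Module.Basis.constr_basis]

theorem hom_ext {M : Type*} [AddCommGroup M] [Module R M] (a : Λ) {F G : S →ₗ[R] M}
    (h : ∀ j i : ℕ, F (D.letter a ^ j * D.pivot a ^ i) = G (D.letter a ^ j * D.pivot a ^ i)) :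
    F = G :=
  (D.basis a).ext fun jl => by rw [D.basis_apply]; exact h _ _

theorem act_letter_mul (a : Λ) (s : S) :
    D.act T a (D.letter a * s) = consEnd R V a * D.act T a s := by
  have := D.hom_ext a (F := D.act T a ∘ₗ LinearMap.mulLeft R (D.letter a))
    (G := LinearMap.mulLeft R (consEnd R V a) ∘ₗ D.act T a) fun j i => by
      simp only [LinearMap.comp_apply, LinearMap.mulLeft_apply]
      rw [← mul_assoc, ← pow_succ', act_basis, act_basis, pow_succ', mul_assoc]
  exact LinearMap.congr_fun this s

theorem act_letter_pow_mul (a : Λ) (j : ℕ) (s : S) :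
    D.act T a (D.letter a ^ j * s) = consEnd R V a ^ j * D.act T a s := by
  induction j with
  | zero => simp
  | succ j ih => rw [pow_succ', mul_assoc, act_letter_mul, ih, pow_succ', mul_assoc]

theorem act_mul_letter (a : Λ) (s : S) :
    D.act T a (s * D.letter a) = D.act T a s * consEnd R V a := by
  have := D.hom_ext a (F := D.act T a ∘ₗ LinearMap.mulRight R (D.letter a))
    (G := LinearMap.mulRight R (consEnd R V a) ∘ₗ D.act T a) fun j i => by
      simp only [LinearMap.comp_apply, LinearMap.mulRight_apply]
      rw [mul_assoc, act_letter_pow_mul, act_basis, mul_assoc, pivotPow_mul_consEnd]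
  exact LinearMap.congr_fun this s

theorem act_mul_letter_pow (a : Λ) (j : ℕ) (s : S) :
    D.act T a (s * D.letter a ^ j) = D.act T a s * consEnd R V a ^ j := by
  induction j with
  | zero => simp
  | succ j ih => rw [pow_succ, ← mul_assoc, act_mul_letter, ih, pow_succ, mul_assoc]

theorem act_pivot_pow (a : Λ) (i : ℕ) : D.act T a (D.pivot a ^ i) = D.pivotPow T i := by
  simpa using D.act_basis T a 0 i

theorem act_mul_pivot_pow_apply {m : List Λ →₀ V}
    (hm : ∀ i l : ℕ, D.pivotPow T i (D.pivotPow T l m) = D.pivotPow T (i + l) m)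
    (a : Λ) (s : S) (l : ℕ) :
    D.act T a (s * D.pivot a ^ l) m = D.act T a s (D.pivotPow T l m) := by
  have := D.hom_ext a
    (F := LinearMap.applyₗ m ∘ₗ D.act T a ∘ₗ LinearMap.mulRight R (D.pivot a ^ l))
    (G := LinearMap.applyₗ (D.pivotPow T l m) ∘ₗ D.act T a) fun j i => by
      simp only [LinearMap.comp_apply, LinearMap.mulRight_apply, LinearMap.applyₗ_apply_apply]
      rw [mul_assoc, ← pow_add, act_basis, act_basis, Module.End.mul_apply, Module.End.mul_apply,
        hm]
  exact LinearMap.congr_fun this s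

theorem act_mul_apply {m : List Λ →₀ V}
    (hm : ∀ i l : ℕ, D.pivotPow T i (D.pivotPow T l m) = D.pivotPow T (i + l) m)
    (a : Λ) (s s' : S) : D.act T a (s * s') m = D.act T a s (D.act T a s' m) := by
  have := D.hom_ext a (F := LinearMap.applyₗ m ∘ₗ D.act T a ∘ₗ LinearMap.mulLeft R s)
    (G := D.act T a s ∘ₗ LinearMap.applyₗ m ∘ₗ D.act T a) fun j i => by
      simp only [LinearMap.comp_apply, LinearMap.mulLeft_apply, LinearMap.applyₗ_apply_apply]
      rw [← mul_assoc, D.act_mul_pivot_pow_apply T hm, act_mul_letter_pow, act_basis,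
        Module.End.mul_apply, Module.End.mul_apply]
  exact LinearMap.congr_fun this s'

theorem pivotPow_pivotPow (m : List Λ →₀ V) (i l : ℕ) :
    D.pivotPow T i (D.pivotPow T l m) = D.pivotPow T (i + l) m := by
  induction m using Finsupp.induction_linear generalizing i l with
  | zero => simp
  | add m m' h h' => simp only [map_add, h, h']
  | single u v =>
    induction u generalizing v i l with
    | nil => simp [pivotPow_single, wordPow, pow_add]
    | cons a u ih =>
      have key : ∀ i, D.pivotPow T i (Finsupp.single (a :: u) v) =
          D.act T a (D.pivot a ^ i * D.letter a) (Finsupp.single u v) := by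
        intro i
        rw [← pivotPow_mul_consEnd, Module.End.mul_apply, consEnd_single]
      rw [key, key, ← D.act_pivot_pow T a i,
        ← D.act_mul_apply T (fun i l => ih v i l), ← mul_assoc, pow_add]

theorem pivotPow_zero : D.pivotPow T 0 = 1 := by
  refine Finsupp.lhom_ext fun u v => ?_
  induction u with
  | nil => simp [pivotPow_single, wordPow]
  | cons a u ih =>
    rw [← consEnd_single (R := R), ← Module.End.mul_apply, pivotPow_mul_consEnd, pow_zero, one_mul,
      ← mul_one (D.letter a), act_letter_mul, ← pow_zero (D.pivot a), act_pivot_pow,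
      Module.End.mul_apply, ih]
    simp

/-- The operator `T` extends to words with coefficients in `V`, so that every letter and the
extended operator satisfy the relations of `S`. -/
theorem exists_extension : ∃ P : Module.End R (List Λ →₀ V),
    (∀ v, P (Finsupp.single [] v) = Finsupp.single [] (T v)) ∧
    ∀ a, ∃ φ : S →ₐ[R] Module.End R (List Λ →₀ V),
      φ (D.letter a) = consEnd R V a ∧ φ (D.pivot a) = P := by
  refine ⟨D.pivotPow T 1, fun v => by simp [pivotPow_single, wordPow], fun a => ?_⟩
  have h1 : D.act T a 1 = 1 := by
    rw [← pow_zero (D.pivot a), act_pivot_pow, pivotPow_zero]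
  refine ⟨AlgHom.ofLinearMap (D.act T a) h1 fun s s' => LinearMap.ext fun m =>
    D.act_mul_apply T (D.pivotPow_pivotPow T m) a s s', ?_, ?_⟩
  · have := D.act_letter_mul T a 1
    rwa [mul_one, h1, mul_one] at this
  · simpa using D.act_pivot_pow T a 1

end LetterData

end WordModule

section Representation

variable {R : Type*} [CommRing R] {π : R}

/-- The data for which the pivot plays the role of `y` with the letter `a` and the role of `x` with
the other letters. -/
theorem exists_letterData (hπ : IsNilpotent π) (f : R[X]) {Λ : Type*} [DecidableEq Λ] (a : Λ) :
    ∃ D : LetterData R (ShiftAlgebra π f) Λ,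
      (D.letter a = ShiftAlgebra.y π f ∧ D.pivot a = ShiftAlgebra.x π f) ∧
      ∀ b ≠ a, D.letter b = ShiftAlgebra.x π f ∧ D.pivot b = ShiftAlgebra.y π f := by
  obtain ⟨β, hβ⟩ := ShiftAlgebra.exists_basis_x_y π f
  obtain ⟨γ, hγ⟩ := ShiftAlgebra.exists_basis_y_x (f := f) hπ
  refine ⟨⟨fun b => if b = a then ShiftAlgebra.y π f else ShiftAlgebra.x π f,
    fun b => if b = a then ShiftAlgebra.x π f else ShiftAlgebra.y π f,
    fun b => if b = a then γ else β, fun b jl => ?_⟩, by simp, fun b hb => by simp [hb]⟩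
  split_ifs
  · exact hγ jl
  · exact hβ jl

theorem ShiftAlgebra.rel_map {f : R[X]} {A : Type*} [Ring A] [Algebra R A]
    (φ : ShiftAlgebra π f →ₐ[R] A) {a b : A} (ha : φ (ShiftAlgebra.x π f) = a)
    (hb : φ (ShiftAlgebra.y π f) = b) : b * a = a * aeval b (X + C π * f) + aeval b f := by
  have h := congrArg φ (ShiftAlgebra.rel π f)
  rwa [map_mul, map_add, map_mul, ← aeval_algHom_apply, ← aeval_algHom_apply, ha, hb] at h

/-- A representation of the cyclic relations on words with coefficients in words: `1` and `3`
prefix the outer word, and `0` and `2` prefix the inner word when the outer word is empty. -/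
theorem exists_cyclic_representation (hπ : IsNilpotent π) (f : R[X]) :
    ∃ T : Fin 4 → Module.End R (List (Fin 4) →₀ (List (Fin 4) →₀ R)),
      (∀ i, T (i + 1) * T i = T i * aeval (T (i + 1)) (X + C π * f) + aeval (T (i + 1)) f) ∧
      (∀ j, j = 1 ∨ j = 3 → T j = consEnd R _ j) ∧
      ∀ j, j = 0 ∨ j = 2 → ∀ v,
        T j (Finsupp.single [] v) = Finsupp.single [] (consEnd R R j v) := by
  obtain ⟨D₀, ⟨hl₀, hp₀⟩, h₀⟩ := exists_letterData hπ f (1 : Fin 4)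
  obtain ⟨D₂, ⟨hl₂, hp₂⟩, h₂⟩ := exists_letterData hπ f (3 : Fin 4)
  obtain ⟨P₀, hP₀, hφ₀⟩ := D₀.exists_extension (consEnd R R (0 : Fin 4))
  obtain ⟨P₂, hP₂, hφ₂⟩ := D₂.exists_extension (consEnd R R (2 : Fin 4))
  refine ⟨![P₀, consEnd R _ 1, P₂, consEnd R _ 3], ?_, ?_, ?_⟩
  · intro i
    fin_cases i
    · obtain ⟨φ, hl, hp⟩ := hφ₀ 1
      exact ShiftAlgebra.rel_map φ (hp₀ ▸ hp) (hl₀ ▸ hl)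
    · obtain ⟨φ, hl, hp⟩ := hφ₂ 1
      exact ShiftAlgebra.rel_map φ ((h₂ 1 (by decide)).1 ▸ hl) ((h₂ 1 (by decide)).2 ▸ hp)
    · obtain ⟨φ, hl, hp⟩ := hφ₂ 3
      exact ShiftAlgebra.rel_map φ (hp₂ ▸ hp) (hl₂ ▸ hl)
    · obtain ⟨φ, hl, hp⟩ := hφ₀ 3
      exact ShiftAlgebra.rel_map φ ((h₀ 3 (by decide)).1 ▸ hl) ((h₀ 3 (by decide)).2 ▸ hp)
  · rintro j (rfl | rfl) <;> rfl
  · rintro j (rfl | rfl)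
    exacts [hP₀, hP₂]

theorem prod_map_single {T : Fin 4 → Module.End R (List (Fin 4) →₀ (List (Fin 4) →₀ R))}
    (h₁ : ∀ j, j = 1 ∨ j = 3 → T j = consEnd R _ j)
    (h₀ : ∀ j, j = 0 ∨ j = 2 → ∀ v,
      T j (Finsupp.single [] v) = Finsupp.single [] (consEnd R R j v))
    {u w : List (Fin 4)} (hu : ∀ j ∈ u, j = 1 ∨ j = 3) (hw : ∀ j ∈ w, j = 0 ∨ j = 2) :
    ((u.map T).prod * (w.map T).prod) (Finsupp.single [] (Finsupp.single [] 1)) =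
      Finsupp.single u (Finsupp.single w 1) := by
  have h : (w.map T).prod (Finsupp.single [] (Finsupp.single [] 1)) =
      Finsupp.single [] (Finsupp.single w 1) := by
    induction w with
    | nil => simp
    | cons j w ih =>
      rw [List.map_cons, List.prod_cons, Module.End.mul_apply,
        ih fun i hi => hw i (List.mem_cons_of_mem _ hi), h₀ j (hw j List.mem_cons_self),
        consEnd_single]
  rw [Module.End.mul_apply, h]
  induction u with
  | nil => simp
  | cons j u ih =>
    rw [List.map_cons, List.prod_cons, Module.End.mul_apply,
      ih fun i hi => hu i (List.mem_cons_of_mem _ hi), h₁ j (hu j List.mem_cons_self),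
      consEnd_single]

theorem linearIndependent_single_single (R α β : Type*) [CommRing R] :
    LinearIndependent R
      (fun ij : α × β => Finsupp.single ij.1 (Finsupp.single ij.2 (1 : R))) := by
  convert ((Finsupp.basis fun _ : α => Finsupp.basisSingleOne (R := R) (ι := β)).reindex
    (Equiv.sigmaEquivProd α β)).linearIndependent using 1
  ext1 ⟨i, j⟩
  simp

end Representation

section Generators

theorem exists_one_add_mul_X_pow (p k : ℕ) (hk : 1 ≤ k) (hdvd : p ∣ k - 1) :
    ∃ f : ℤ[X], (1 + (p : ℤ[X]) * X) ^ k = 1 + (p : ℤ[X]) * X + (p : ℤ[X]) ^ 2 * f := by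
  have h : ∀ k : ℕ, ∃ e : ℤ[X],
      (1 + (p : ℤ[X]) * X) ^ k = 1 + (k : ℤ[X]) * ((p : ℤ[X]) * X) + (p : ℤ[X]) ^ 2 * e := by
    intro k
    induction k with
    | zero => exact ⟨0, by simp⟩
    | succ k ih =>
      obtain ⟨e, he⟩ := ih
      refine ⟨e * (1 + (p : ℤ[X]) * X) + (k : ℤ[X]) * X ^ 2, ?_⟩
      rw [pow_succ, he]
      push_cast
      ring
  obtain ⟨m, hm⟩ := hdvd
  obtain ⟨e, he⟩ := h k
  refine ⟨(m : ℤ[X]) * X + e, ?_⟩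
  rw [he, show k = p * m + 1 by omega]
  push_cast
  ring

/-- The quotient by `p ^ 2` of `(1 + p y) (1 + p x) - (1 + p x) (1 + p y) ^ k`. -/
theorem eq_of_sq_smul_eq {A : Type*} [Ring A] [IsAddTorsionFree A] {p k : ℕ} (hp : p ≠ 0)
    {f : ℤ[X]} (hf : (1 + (p : ℤ[X]) * X) ^ k = 1 + (p : ℤ[X]) * X + (p : ℤ[X]) ^ 2 * f)
    {x y h : A} (hh : ((p : ℤ) ^ 2) • h =
      (1 + (p : A) * y) * (1 + (p : A) * x) - (1 + (p : A) * x) * (1 + (p : A) * y) ^ k) :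
    h = y * x - x * (y + (p : A) * aeval y f) - aeval y f := by
  have hf' := congrArg (aeval y) hf
  simp only [map_pow, map_add, map_mul, map_one, map_natCast, aeval_X] at hf'
  refine zsmul_right_injective (pow_ne_zero 2 (Int.natCast_ne_zero.2 hp)) ?_
  change ((p : ℤ) ^ 2) • h = ((p : ℤ) ^ 2) • _
  rw [hh, hf', zsmul_eq_mul]
  push_cast
  have hc : ∀ a : A, a * (p : A) = p * a := fun a => (Nat.cast_commute p a).eq.symm
  have hc' : ∀ a b : A, a * ((p : A) * b) = (p : A) * (a * b) := fun a b => by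
    rw [← mul_assoc, hc, mul_assoc]
  simp only [mul_add, add_mul, mul_sub, mul_one, one_mul, pow_two, mul_assoc, hc']
  abel

theorem map_relator {R A B : Type*} [CommRing R] [Ring A] [Algebra R A] [Ring B] (φ : B →+* A)
    (f : ℤ[X]) (p : ℕ) (x y : B) :
    φ (y * x - x * (y + (p : B) * aeval y f) - aeval y f) =
      φ y * φ x - φ x * aeval (φ y) (X + C (p : R) * f.map (algebraMap ℤ R)) -
        aeval (φ y) (f.map (algebraMap ℤ R)) := by
  have h : φ (aeval y f) = aeval (φ y) f := (aeval_algHom_apply φ.toIntAlgHom y f).symm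
  simp only [map_sub, map_mul, map_add, map_natCast, h, aeval_map_algebraMap, aeval_X]

end Generators

section Quotient

variable {R : Type*} [CommRing R] {π : R} {f : R[X]} {A : Type*} [Ring A] [Algebra R A]

theorem map_relator_eq_zero_iff {B : Type*} [Ring B] [Algebra R B] (φ : B →ₐ[R] A) (x y : B) :
    φ (y * x - x * aeval y (X + C π * f) - aeval y f) = 0 ↔
      φ y * φ x = φ x * aeval (φ y) (X + C π * f) + aeval (φ y) f := by
  rw [map_sub, map_sub, map_mul, map_mul, ← aeval_algHom_apply, ← aeval_algHom_apply, sub_sub,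
    sub_eq_zero]

/-- Elements of the algebra with cyclic relations are independent if they are so after acting on a
vector of a representation. -/
theorem linearIndependent_mk_of_apply {E ι : Type*} [AddCommGroup E] [Module R E]
    {g : Fin 4 → FreeAlgebra R (Fin 4)}
    (hg : ∀ i, g i = FreeAlgebra.ι R (i + 1) * FreeAlgebra.ι R i -
      FreeAlgebra.ι R i * aeval (FreeAlgebra.ι R (i + 1)) (X + C π * f) -
        aeval (FreeAlgebra.ι R (i + 1)) f) {T : Fin 4 → Module.End R E}
    (hT : ∀ i, T (i + 1) * T i = T i * aeval (T (i + 1)) (X + C π * f) + aeval (T (i + 1)) f)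
    (e : E) {v : ι → FreeAlgebra R (Fin 4)}
    (hv : LinearIndependent R fun i => FreeAlgebra.lift R T (v i) e) :
    LinearIndependent R fun i =>
      RingCon.mk' (TwoSidedIdeal.span {g 0, g 1, g 2, g 3}).ringCon (v i) := by
  have hker : ∀ i, FreeAlgebra.lift R T (g i) = 0 := by
    intro i
    rw [hg, map_relator_eq_zero_iff]
    simpa only [FreeAlgebra.lift_ι_apply] using hT i
  have hle : TwoSidedIdeal.span {g 0, g 1, g 2, g 3} ≤
      TwoSidedIdeal.ker (FreeAlgebra.lift R T) := by
    rw [TwoSidedIdeal.span_le]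
    rintro _ (rfl | rfl | rfl | rfl) <;> exact (TwoSidedIdeal.mem_ker _).2 (hker _)
  exact LinearIndependent.of_comp (LinearMap.applyₗ e ∘ₗ (RingCon.liftₐ (R := R) _
    (FreeAlgebra.lift R T) fun {_ _} hxy => TwoSidedIdeal.ringCon_le_iff.1 hle hxy).toLinearMap) hv

theorem list_prod_mem_closure_iff {ι : Type*} (X : ι → A) (s : Set ι) (z : A) :
    z ∈ Submonoid.closure (X '' s) ↔ ∃ l : List ι, (∀ j ∈ l, j ∈ s) ∧ (l.map X).prod = z := by
  constructor
  · intro hz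
    induction hz using Submonoid.closure_induction with
    | mem x hx =>
      obtain ⟨j, hj, rfl⟩ := hx
      exact ⟨[j], by simpa using hj, by simp⟩
    | one => exact ⟨[], by simp, by simp⟩
    | mul x y _ _ hx hy =>
      obtain ⟨l, hl, rfl⟩ := hx
      obtain ⟨m, hm, rfl⟩ := hy
      refine ⟨l ++ m, fun j hj => ?_, by simp⟩
      exact (List.mem_append.1 hj).elim (hl j) (hm j)
  · rintro ⟨l, hl, rfl⟩
    refine Submonoid.list_prod_mem _ fun x hx => ?_
    obtain ⟨j, hj, rfl⟩ := List.mem_map.1 hx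
    exact Submonoid.subset_closure ⟨j, hl j hj, rfl⟩

theorem adjoin_mul_adjoin_eq_top (hπ : IsNilpotent π) {T : Fin 4 → A}
    (hT : Algebra.adjoin R (Set.range T) = ⊤)
    (h : ∀ i, T (i + 1) * T i = T i * aeval (T (i + 1)) (X + C π * f) + aeval (T (i + 1)) f) :
    (Algebra.adjoin R (T '' {j | j = 1 ∨ j = 3})).toSubmodule *
      (Algebra.adjoin R (T '' {j | j = 0 ∨ j = 2})).toSubmodule = ⊤ := by
  have hle : ∀ i, (∀ j, j = 1 ∨ j = 3 →
      (Algebra.adjoin R {T i}).toSubmodule * (Algebra.adjoin R {T j}).toSubmodule ≤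
        (Algebra.adjoin R {T j}).toSubmodule * (Algebra.adjoin R {T i}).toSubmodule) →
      (Algebra.adjoin R {T i}).toSubmodule *
          (Algebra.adjoin R (T '' {j | j = 1 ∨ j = 3})).toSubmodule ≤
        (Algebra.adjoin R (T '' {j | j = 1 ∨ j = 3})).toSubmodule *
          (Algebra.adjoin R {T i}).toSubmodule := by
    intro i hi
    refine mul_adjoin_le ?_
    rintro c hc _ ⟨j, hj, rfl⟩
    have hsub : (Algebra.adjoin R {T j}).toSubmodule ≤
        (Algebra.adjoin R (T '' {j | j = 1 ∨ j = 3})).toSubmodule :=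
      Algebra.adjoin_mono (Set.singleton_subset_iff.2 ⟨j, hj, rfl⟩)
    exact mul_le_mul_left hsub _
      (hi j hj (Submodule.mul_mem_mul hc (Algebra.self_mem_adjoin_singleton R _)))
  refine mul_eq_top_of_generators hT ?_
  have hleft : ∀ j, j = 1 ∨ j = 3 → T j ∈ Algebra.adjoin R (T '' {j | j = 1 ∨ j = 3}) :=
    fun j hj => Algebra.subset_adjoin ⟨j, hj, rfl⟩
  have hright : ∀ j, j = 0 ∨ j = 2 →
      Algebra.adjoin R {T j} ≤ Algebra.adjoin R (T '' {j | j = 0 ∨ j = 2}) :=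
    fun j hj => Algebra.adjoin_mono (Set.singleton_subset_iff.2 ⟨j, hj, rfl⟩)
  have hself := fun j => Algebra.self_mem_adjoin_singleton R (T j)
  rintro _ ⟨i, rfl⟩
  fin_cases i
  · refine right_mul_absorb (hright 0 (by simp)) (hle 0 ?_) (hself 0)
    rintro j (rfl | rfl)
    exacts [left_mul_right_le hπ (h 0), right_mul_left_le (h 3)]
  · exact left_mul_absorb (hleft 1 (by simp))
  · refine right_mul_absorb (hright 2 (by simp)) (hle 2 ?_) (hself 2)
    rintro j (rfl | rfl)
    exacts [right_mul_left_le (h 1), left_mul_right_le hπ (h 2)]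
  · exact left_mul_absorb (hleft 3 (by simp))

theorem span_range_list_prod_mul (T : Fin 4 → A) :
    Submodule.span R (Set.range fun uw : {u : List (Fin 4) // ∀ j ∈ u, j = 1 ∨ j = 3} ×
        {w : List (Fin 4) // ∀ j ∈ w, j = 0 ∨ j = 2} =>
          ((uw.1 : List (Fin 4)).map T).prod * ((uw.2 : List (Fin 4)).map T).prod) =
      (Algebra.adjoin R (T '' {j | j = 1 ∨ j = 3})).toSubmodule *
        (Algebra.adjoin R (T '' {j | j = 0 ∨ j = 2})).toSubmodule := by
  rw [Algebra.adjoin_eq_span, Algebra.adjoin_eq_span, Submodule.span_mul_span]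
  congr 1
  ext z
  simp [Set.mem_mul, list_prod_mem_closure_iff, -Set.mem_insert_iff]

end Quotient

section Basis

variable {R : Type*} [CommRing R] {π : R}

/-- The monomials `X^u * X^w`, with `u` a word in `1, 3` and `w` a word in `0, 2`, form a basis of
the algebra with cyclic relations `X_{i+1} X_i = X_i (X_{i+1} + π f(X_{i+1})) + f(X_{i+1})`. -/
theorem cyclic_algebra_basis (hπ : IsNilpotent π) (f : R[X]) (g : Fin 4 → FreeAlgebra R (Fin 4))
    (hg : ∀ i, g i = FreeAlgebra.ι R (i + 1) * FreeAlgebra.ι R i -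
      FreeAlgebra.ι R i * aeval (FreeAlgebra.ι R (i + 1)) (X + C π * f) -
        aeval (FreeAlgebra.ι R (i + 1)) f) :
    let I := TwoSidedIdeal.span {g 0, g 1, g 2, g 3}
    let b : {u : List (Fin 4) // ∀ j ∈ u, j = 1 ∨ j = 3} ×
            {w : List (Fin 4) // ∀ j ∈ w, j = 0 ∨ j = 2} → I.ringCon.Quotient := fun uw =>
      RingCon.mk' I.ringCon
        (((uw.1 : List (Fin 4)).map (FreeAlgebra.ι R)).prod *
         ((uw.2 : List (Fin 4)).map (FreeAlgebra.ι R)).prod)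
    LinearIndependent R b ∧ Submodule.span R (Set.range b) = ⊤ := by
  intro I b
  obtain ⟨T, hT, hT₁, hT₀⟩ := exists_cyclic_representation hπ f
  let q : FreeAlgebra R (Fin 4) →ₐ[R] I.ringCon.Quotient :=
    RingCon.mkₐ R I.ringCon
  have hI : ∀ i, q (g i) = 0 := fun i =>
    (RingCon.eq _).2 ((TwoSidedIdeal.mem_iff _ _).1
      (TwoSidedIdeal.subset_span (by fin_cases i <;> simp)))
  constructor
  · refine linearIndependent_mk_of_apply (E := List (Fin 4) →₀ (List (Fin 4) →₀ R)) hg hT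
      (Finsupp.single [] (Finsupp.single [] 1)) ?_
    convert (linearIndependent_single_single R (List (Fin 4)) (List (Fin 4))).comp
      (Prod.map Subtype.val Subtype.val)
      (Subtype.val_injective.prodMap Subtype.val_injective) using 2 with uw
    · rw [map_mul, map_list_prod, map_list_prod, List.map_map, List.map_map]
      simp only [FreeAlgebra.ι_comp_lift]
      exact prod_map_single hT₁ hT₀ uw.1.2 uw.2.2
    · rfl
  · have hb : b = fun uw => ((uw.1 : List (Fin 4)).map
        (q ∘ FreeAlgebra.ι R)).prod *
          ((uw.2 : List (Fin 4)).map (q ∘ FreeAlgebra.ι R)).prod := by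
      funext uw
      change q _ = _
      rw [map_mul, map_list_prod, map_list_prod, List.map_map, List.map_map]
    rw [hb, span_range_list_prod_mul]
    refine adjoin_mul_adjoin_eq_top (f := f) hπ ?_ fun i => ?_
    · rw [Set.range_comp, ← AlgHom.map_adjoin, FreeAlgebra.adjoin_range_ι, Algebra.map_top,
        (AlgHom.range_eq_top _).2 (RingCon.mkₐ_surjective _)]
    · have h := hI i
      rw [hg] at h
      exact (map_relator_eq_zero_iff q _ _).1 h

end Basis

end CyclicAlgebra

/-- **Statement 5.** With `p` prime, `n ≥ 1`, `k ≥ 2`, `p ∣ k - 1`, let `h i ∈ FreeAlgebra ℤ (Fin 4)`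
be the (unique) elements with `p² • h i = (1 + p X_{i+1})(1 + p X_i) - (1 + p X_i)(1 + p X_{i+1})^k`
(indices mod 4), let `g i` be their images in `FreeAlgebra (ZMod (p^n)) (Fin 4)` and
`I = I(g_0, g_1, g_2, g_3)` the two-sided ideal they generate. Then the images modulo `I` of the
monomials `X^u * X^w`, for `u` a list over `{1, 3}` and `w` a list over `{0, 2}`, form a basis of
the quotient as a `ZMod (p^n)`-module. -/
theorem higman_algebra_basis_right
    (p n k : ℕ) (hp : Nat.Prime p) (hn : 1 ≤ n) (hk : 2 ≤ k) (hdvd : p ∣ k - 1)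
    (h : Fin 4 → FreeAlgebra ℤ (Fin 4))
    (hh : ∀ i : Fin 4, ((p : ℤ) ^ 2) • h i =
      (1 + (p : FreeAlgebra ℤ (Fin 4)) * FreeAlgebra.ι ℤ (i + 1)) *
        (1 + (p : FreeAlgebra ℤ (Fin 4)) * FreeAlgebra.ι ℤ i) -
      (1 + (p : FreeAlgebra ℤ (Fin 4)) * FreeAlgebra.ι ℤ i) *
        (1 + (p : FreeAlgebra ℤ (Fin 4)) * FreeAlgebra.ι ℤ (i + 1)) ^ k)
    (g : Fin 4 → FreeAlgebra (ZMod (p ^ n)) (Fin 4))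
    (hg : ∀ i, g i = FreeAlgebra.lift ℤ (fun j => FreeAlgebra.ι (ZMod (p ^ n)) j) (h i)) :
    let I := TwoSidedIdeal.span {g 0, g 1, g 2, g 3}
    let b : {u : List (Fin 4) // ∀ j ∈ u, j = 1 ∨ j = 3} ×
            {w : List (Fin 4) // ∀ j ∈ w, j = 0 ∨ j = 2} → I.ringCon.Quotient := fun uw =>
      RingCon.mk' I.ringCon
        (((uw.1 : List (Fin 4)).map (FreeAlgebra.ι (ZMod (p ^ n)))).prod *
         ((uw.2 : List (Fin 4)).map (FreeAlgebra.ι (ZMod (p ^ n)))).prod)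
    LinearIndependent (ZMod (p ^ n)) b ∧
      Submodule.span (ZMod (p ^ n)) (Set.range b) = ⊤ := by
  obtain ⟨F, hF⟩ := exists_one_add_mul_X_pow p k (by omega) hdvd
  have hπ : IsNilpotent (p : ZMod (p ^ n)) := ⟨n, by rw [← Nat.cast_pow, ZMod.natCast_self]⟩
  refine cyclic_algebra_basis hπ (F.map (algebraMap ℤ (ZMod (p ^ n)))) g ?_
  intro i
  rw [hg, eq_of_sq_smul_eq hp.ne_zero hF (hh i)]
  simpa using map_relator (R := ZMod (p ^ n))
    (FreeAlgebra.lift ℤ fun j => FreeAlgebra.ι (ZMod (p ^ n)) j : _ →ₐ[ℤ] _).toRingHom F p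
    (FreeAlgebra.ι ℤ i) (FreeAlgebra.ι ℤ (i + 1))
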